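/- There exists a universal constant C > 0 (independent of d) such that for every integer d ≥ 2 the following holds: if X, Y ≥ 0 are two independent random variables each with probability density function f_Z(z) = (2 / (2^(d/2) · Γ(d/2))) · z^(d−1) · exp(−z²/2) on [0, ∞), then the angle Θ = arctan(Y / X) satisfies Var(Θ) ≤ C / (d − 1). -/

import Mathlib

open MeasureTheory ProbabilityTheory Real

/-- The generalized gamma (chi) density with parameter `d`, as an `ℝ≥0∞`-valued density:
`f_Z(z) = 2 / (2^(d/2) Γ(d/2)) · z^(d-1) · exp(-z²/2)` for `z ≥ 0`. -/
noncomputable def genGammaDensity (d : ℕ) : ℝ → ENNReal :=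
  Set.indicator (Set.Ici (0 : ℝ)) fun z =>
    ENNReal.ofReal
      (2 / (2 ^ ((d : ℝ) / 2) * Real.Gamma ((d : ℝ) / 2)) * z ^ (d - 1) * Real.exp (-z ^ 2 / 2))

lemma abs_arctan_le_abs' (u : ℝ) : |Real.arctan u| ≤ |u| := by
  rcases le_total 0 u with h | h
  · have h1 : 0 ≤ Real.arctan u := Real.arctan_nonneg.2 h
    have := Real.le_tan h1 (Real.arctan_lt_pi_div_two u)
    rw [Real.tan_arctan] at this
    rwa [abs_of_nonneg h1, abs_of_nonneg h]
  · have h1 : 0 ≤ Real.arctan (-u) := Real.arctan_nonneg.2 (by linarith)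
    have := Real.le_tan h1 (Real.arctan_lt_pi_div_two (-u))
    rw [Real.tan_arctan] at this
    rw [← abs_neg u, ← abs_neg (Real.arctan u), ← Real.arctan_neg]
    rwa [abs_of_nonneg h1, abs_of_nonneg (by linarith : 0 ≤ -u)]

lemma pointwise_arctan_bound (x y m : ℝ) (hx : 0 ≤ x) (hy : 0 ≤ y) (hm : 0 < m) :
    (Real.arctan (y / x) - π / 4) ^ 2
      ≤ 2 / m ^ 2 * ((x ^ 2 - m) ^ 2 + (y ^ 2 - m) ^ 2) := by
  rw [div_mul_eq_mul_div, le_div_iff₀ (by positivity)]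
  rcases hx.eq_or_lt with rfl | hx
  · have h1 : (π / 4) ^ 2 ≤ 1 := by
      have := Real.pi_le_four
      have := Real.pi_pos
      nlinarith
    simp only [div_zero, Real.arctan_zero]
    nlinarith [sq_nonneg (y ^ 2 - m), sq_nonneg m]
  · have ht : 0 ≤ y / x := by positivity
    have h1 : Real.arctan (y / x) - π / 4 = Real.arctan ((y - x) / (y + x)) := by
      have := Real.arctan_add (x := y / x) (y := -1) (by linarith)
      rw [Real.arctan_neg, Real.arctan_one] at this
      rw [sub_eq_add_neg, this]
      congr 1
      have hs : y + x ≠ 0 := by positivity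
      have hs' : 1 - y / x * -1 ≠ 0 := by
        have : 1 - y / x * -1 = 1 + y / x := by ring
        rw [this]; positivity
      rw [div_eq_div_iff hs' hs]
      field_simp
      ring
    have h2 : (Real.arctan (y / x) - π / 4) ^ 2 ≤ ((y - x) / (y + x)) ^ 2 := by
      rw [h1]; exact sq_le_sq.2 (abs_arctan_le_abs' _)
    have hs : 0 < y + x := by linarith
    have h3 : ((y - x) / (y + x)) ^ 2 ≤ ((y ^ 2 - x ^ 2) / (y ^ 2 + x ^ 2)) ^ 2 := by
      apply sq_le_sq.2
      rw [abs_div, abs_div, abs_of_pos hs, abs_of_pos (by positivity : 0 < y ^ 2 + x ^ 2),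
        div_le_div_iff₀ hs (by positivity),
        show y ^ 2 - x ^ 2 = (y - x) * (y + x) by ring, abs_mul, abs_of_pos hs, mul_assoc]
      apply mul_le_mul_of_nonneg_left _ (abs_nonneg _)
      nlinarith [mul_nonneg hx.le hy]
    refine (mul_le_mul_of_nonneg_right (h2.trans h3) (sq_nonneg m)).trans ?_
    have ha : 0 < x ^ 2 := by positivity
    have hb : 0 ≤ y ^ 2 := by positivity
    generalize x ^ 2 = a at *
    generalize y ^ 2 = b at *
    have hab : 0 < b + a := by linarith
    rcases le_total m (b + a) with h | h
    · rw [div_pow, div_mul_eq_mul_div, div_le_iff₀ (by positivity)]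
      calc (b - a) ^ 2 * m ^ 2 ≤ (2 * ((a - m) ^ 2 + (b - m) ^ 2)) * m ^ 2 := by
            apply mul_le_mul_of_nonneg_right _ (sq_nonneg m)
            nlinarith [sq_nonneg (a + b - 2 * m)]
        _ ≤ _ := by
            apply mul_le_mul_of_nonneg_left _ (by positivity)
            exact pow_le_pow_left₀ hm.le h 2
    · have h4 : ((b - a) / (b + a)) ^ 2 ≤ 1 := by
        rw [div_pow, div_le_one (by positivity)]
        nlinarith
      nlinarith [sq_nonneg (a - b), sq_nonneg m, mul_nonneg (sub_nonneg.2 h) hm.le]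

lemma chi_base (n : ℕ) :
    IntegrableOn (fun x : ℝ => x ^ n * Real.exp (-x ^ 2 / 2)) (Set.Ioi 0) ∧
    ∫ x in Set.Ioi (0 : ℝ), x ^ n * Real.exp (-x ^ 2 / 2)
      = 2 ^ (((n : ℝ) + 1) / 2) * (1 / 2) * Real.Gamma (((n : ℝ) + 1) / 2) := by
  have hn : (-1 : ℝ) < n := by have : (0 : ℝ) ≤ n := n.cast_nonneg
                               linarith
  have e : (fun x : ℝ => x ^ n * Real.exp (-x ^ 2 / 2))
      = fun x : ℝ => x ^ (n : ℝ) * Real.exp (-(1 / 2) * x ^ (2 : ℝ)) := by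
    ext x
    rw [Real.rpow_natCast, Real.rpow_two]
    ring_nf
  rw [e]
  refine ⟨integrableOn_rpow_mul_exp_neg_mul_rpow hn (by norm_num) (by norm_num), ?_⟩
  rw [integral_rpow_mul_exp_neg_mul_rpow (by norm_num) hn (by norm_num)]
  congr 2
  rw [one_div, Real.inv_rpow (by norm_num), ← Real.rpow_neg (by norm_num)]
  ring_nf

lemma genGammaDensity_meas (d : ℕ) : Measurable (genGammaDensity d) := by
  unfold genGammaDensity
  exact Measurable.indicator (by fun_prop) measurableSet_Ici

lemma genGammaDensity_fin (d : ℕ) : ∀ᵐ x : ℝ, genGammaDensity d x < ⊤ := by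
  refine Filter.Eventually.of_forall fun x => ?_
  unfold genGammaDensity Set.indicator
  split_ifs <;> simp

lemma chi_mom (d : ℕ) (hd : 2 ≤ d) (k : ℕ) :
    Integrable (fun x : ℝ => x ^ (2 * k)) (volume.withDensity (genGammaDensity d)) ∧
    ∫ x, x ^ (2 * k) ∂(volume.withDensity (genGammaDensity d))
      = 2 ^ k * Real.Gamma ((d : ℝ) / 2 + k) / Real.Gamma ((d : ℝ) / 2) := by
  have hd0 : (0 : ℝ) < (d : ℝ) / 2 := by
    have : (2 : ℝ) ≤ d := by exact_mod_cast hd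
    linarith
  have hG := Real.Gamma_pos_of_pos hd0
  set c : ℝ := 2 / (2 ^ ((d : ℝ) / 2) * Real.Gamma ((d : ℝ) / 2)) with hc
  have hc0 : 0 < c := by positivity
  have e : (fun x : ℝ => (genGammaDensity d x).toReal • x ^ (2 * k))
      = Set.indicator (Set.Ici 0)
        (fun x : ℝ => c * (x ^ (d - 1 + 2 * k) * Real.exp (-x ^ 2 / 2))) := by
    ext x
    unfold genGammaDensity
    by_cases hx : x ∈ Set.Ici (0 : ℝ)
    · have hx' : 0 ≤ x := hx
      rw [Set.indicator_of_mem hx, Set.indicator_of_mem hx, ENNReal.toReal_ofReal (by positivity),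
        smul_eq_mul, pow_add]
      ring
    · rw [Set.indicator_of_notMem hx, Set.indicator_of_notMem hx]; simp
  obtain ⟨h1, h2⟩ := chi_base (d - 1 + 2 * k)
  constructor
  · rw [integrable_withDensity_iff_integrable_smul' (genGammaDensity_meas d)
      (genGammaDensity_fin d), e, integrable_indicator_iff measurableSet_Ici,
      integrableOn_Ici_iff_integrableOn_Ioi]
    exact h1.const_mul c
  · rw [integral_withDensity_eq_integral_toReal_smul (genGammaDensity_meas d)
      (genGammaDensity_fin d), e, integral_indicator measurableSet_Ici,
      integral_Ici_eq_integral_Ioi, integral_const_mul, h2]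
    have e2 : (((d - 1 + 2 * k : ℕ) : ℝ) + 1) / 2 = (d : ℝ) / 2 + k := by
      push_cast [Nat.cast_sub (by omega : 1 ≤ d)]
      ring
    rw [e2, Real.rpow_add (by norm_num), Real.rpow_natCast, hc]
    have : (0 : ℝ) < 2 ^ ((d : ℝ) / 2) := by positivity
    field_simp

lemma chi_sq_dev (d : ℕ) (hd : 2 ≤ d) :
    Integrable (fun x : ℝ => (x ^ 2 - d) ^ 2) (volume.withDensity (genGammaDensity d)) ∧
    ∫ x, (x ^ 2 - d) ^ 2 ∂(volume.withDensity (genGammaDensity d)) = 2 * d := by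
  have hd0 : (0 : ℝ) < (d : ℝ) / 2 := by
    have : (2 : ℝ) ≤ d := by exact_mod_cast hd
    linarith
  have hG := Real.Gamma_pos_of_pos hd0
  obtain ⟨i0, m0⟩ := chi_mom d hd 0
  obtain ⟨i1, m1⟩ := chi_mom d hd 1
  obtain ⟨i2, m2⟩ := chi_mom d hd 2
  have g1 : Real.Gamma ((d : ℝ) / 2 + 1) = (d : ℝ) / 2 * Real.Gamma ((d : ℝ) / 2) :=
    Real.Gamma_add_one hd0.ne'
  have g2 : Real.Gamma ((d : ℝ) / 2 + 2)
      = ((d : ℝ) / 2 + 1) * ((d : ℝ) / 2 * Real.Gamma ((d : ℝ) / 2)) := by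
    rw [← g1, ← Real.Gamma_add_one (by positivity)]
    congr 1; ring
  have e : (fun x : ℝ => (x ^ 2 - (d : ℝ)) ^ 2)
      = fun x => (x ^ (2 * 2) - 2 * d * x ^ (2 * 1)) + (d : ℝ) ^ 2 * x ^ (2 * 0) := by
    ext x; ring
  have j1 := i1.const_mul (2 * (d : ℝ))
  have j0 := i0.const_mul ((d : ℝ) ^ 2)
  rw [e]
  have j2 : Integrable (fun x : ℝ => x ^ (2 * 2) - 2 * (d : ℝ) * x ^ (2 * 1))
      (volume.withDensity (genGammaDensity d)) := i2.sub j1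
  refine ⟨j2.add j0, ?_⟩
  rw [integral_add j2 j0, integral_sub i2 j1, integral_const_mul, integral_const_mul,
    m0, m1, m2]
  push_cast
  rw [g1, g2, add_zero]
  field_simp
  ring

/-- There is a universal constant `C > 0` such that for every `d ≥ 2`, if `X, Y ≥ 0` are
independent random variables each with the generalized gamma (chi) density of parameter `d`,
then `Θ = arctan(Y/X)` has variance at most `C / (d - 1)`. -/
theorem arctan_ratio_of_chi_variance :
    ∃ C : ℝ, 0 < C ∧
      ∀ (d : ℕ), 2 ≤ d →
        ∀ (Ω : Type) (_ : MeasureSpace Ω) (_ : IsProbabilityMeasure (ℙ : Measure Ω))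
          (X Y : Ω → ℝ), Measurable X → Measurable Y →
          (∀ ω, 0 ≤ X ω) → (∀ ω, 0 ≤ Y ω) →
          IndepFun X Y ℙ →
          Measure.map X ℙ = volume.withDensity (genGammaDensity d) →
          Measure.map Y ℙ = volume.withDensity (genGammaDensity d) →
          variance (fun ω => Real.arctan (Y ω / X ω)) ℙ ≤ C / ((d : ℝ) - 1) := by
  refine ⟨8, by norm_num, ?_⟩
  intro d hd Ω _ _ X Y hX hY hX0 hY0 _ hXl hYl
  have hd2 : (2 : ℝ) ≤ d := by exact_mod_cast hd
  have hd0 : (0 : ℝ) < d := by linarith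
  obtain ⟨i, m⟩ := chi_sq_dev d hd
  have key : ∀ Z : Ω → ℝ, Measurable Z →
      Measure.map Z ℙ = volume.withDensity (genGammaDensity d) →
      Integrable (fun ω => (Z ω ^ 2 - (d : ℝ)) ^ 2) (ℙ : Measure Ω) ∧
      ∫ ω, (Z ω ^ 2 - (d : ℝ)) ^ 2 ∂(ℙ : Measure Ω) = 2 * d := by
    intro Z hZ hl
    rw [← hl] at i m
    refine ⟨i.comp_measurable hZ, ?_⟩
    rw [← m, integral_map hZ.aemeasurable i.aestronglyMeasurable]
  obtain ⟨iX, mX⟩ := key X hX hXl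
  obtain ⟨iY, mY⟩ := key Y hY hYl
  have hm : Measurable (fun ω => Real.arctan (Y ω / X ω)) :=
    Real.measurable_arctan.comp (hY.div hX)
  rw [← variance_sub_const hm.aestronglyMeasurable (π / 4)]
  refine (variance_le_expectation_sq (hm.sub_const _).aestronglyMeasurable).trans ?_
  have h1 : ∫ ω, (Real.arctan (Y ω / X ω) - π / 4) ^ 2 ∂(ℙ : Measure Ω)
      ≤ ∫ ω, 2 / (d : ℝ) ^ 2 * ((X ω ^ 2 - d) ^ 2 + (Y ω ^ 2 - d) ^ 2) ∂(ℙ : Measure Ω) := by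
    apply integral_mono_of_nonneg
    · exact Filter.Eventually.of_forall fun ω => sq_nonneg _
    · exact (iX.add iY).const_mul _
    · exact Filter.Eventually.of_forall fun ω =>
        pointwise_arctan_bound _ _ _ (hX0 ω) (hY0 ω) hd0
  refine le_trans h1 ?_
  rw [integral_const_mul, integral_add iX iY, mX, mY]
  have : 2 / (d : ℝ) ^ 2 * (2 * d + 2 * d) = 8 / d := by field_simp; ring
  rw [this]
  exact div_le_div_of_nonneg_left (by norm_num) (by linarith) (by linarith)
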